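/- For every real x > 0 and every natural number N ≥ 1, the remainder of the Stirling series satisfies |log Γ(x) − (log √(2π) + (x − 1/2)·log x − x) − Σ_{n=1}^{N} B_{2n}/(2n(2n−1)·x^{2n−1})| ≤ |B_{2N+2}|/((2N+2)(2N+1)·x^{2N+1}); i.e. the error of the truncated Stirling series is bounded in absolute value by the first omitted term. -/

import Mathlib

open Real Finset

/-- Integration by parts for the kernels `B_k(t) / (x+t)^k`. -/
lemma stir_parts (x : ℝ) (hx : 0 < x) (k : ℕ) (c : ℝ) :
    ∫ t in (0:ℝ)..1, bernoulliFun k t * ((x + t) ^ k)⁻¹ =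
      (bernoulliFun (k + 1) 1 - c) / (k + 1) * ((x + 1) ^ k)⁻¹
      - (bernoulliFun (k + 1) 0 - c) / (k + 1) * (x ^ k)⁻¹
      + k / (k + 1) * ∫ t in (0:ℝ)..1, (bernoulliFun (k + 1) t - c) * ((x + t) ^ (k + 1))⁻¹ := by
  have hk : (k : ℝ) + 1 ≠ 0 := by positivity
  have hpos : ∀ t ∈ Set.uIcc (0:ℝ) 1, 0 < x + t := by
    intro t ht
    rw [Set.uIcc_of_le zero_le_one] at ht
    linarith [ht.1]
  have hcont : ∀ m : ℕ, ContinuousOn (fun t : ℝ => ((x + t) ^ m)⁻¹) (Set.uIcc (0:ℝ) 1) := by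
    intro m
    apply ContinuousOn.inv₀
    · fun_prop
    · intro t ht
      exact pow_ne_zero _ (hpos t ht).ne'
  have hv : ∀ t ∈ Set.uIcc (0:ℝ) 1,
      HasDerivAt (fun t => (bernoulliFun (k + 1) t - c) / (k + 1)) (bernoulliFun k t) t := by
    intro t _
    have := ((hasDerivAt_bernoulliFun (k + 1) t).sub_const c).div_const ((k : ℝ) + 1)
    convert! this using 1
    push_cast
    field_simp
  have hu : ∀ t ∈ Set.uIcc (0:ℝ) 1,
      HasDerivAt (fun t : ℝ => ((x + t) ^ k)⁻¹) (-(k : ℝ) * ((x + t) ^ (k + 1))⁻¹) t := by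
    intro t ht
    have h0 := (hpos t ht).ne'
    have h1 := (((hasDerivAt_id t).const_add x).pow k).inv (pow_ne_zero k h0)
    convert! h1 using 1
    rcases k with _ | k
    · simp
    · simp
      field_simp
      ring
  have key := intervalIntegral.integral_mul_deriv_eq_deriv_mul hu hv
    (((hcont (k + 1)).const_smul (-(k:ℝ))).intervalIntegrable)
    ((continuous_bernoulliFun k).intervalIntegrable _ _)
  simp only [add_zero] at key
  have e1 : ∫ t in (0:ℝ)..1, bernoulliFun k t * ((x + t) ^ k)⁻¹
      = ∫ t in (0:ℝ)..1, ((x + t) ^ k)⁻¹ * bernoulliFun k t := by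
    congr 1; ext t; ring
  have e2 : ∫ t in (0:ℝ)..1, -(k : ℝ) * ((x + t) ^ (k + 1))⁻¹
        * ((bernoulliFun (k + 1) t - c) / (k + 1))
      = -(k / (k + 1) * ∫ t in (0:ℝ)..1, (bernoulliFun (k + 1) t - c) * ((x + t) ^ (k + 1))⁻¹) := by
    rw [← neg_mul, ← intervalIntegral.integral_const_mul]
    congr 1; ext t; ring
  rw [e1, key, e2]
  ring

lemma stir_J1 (x : ℝ) (hx : 0 < x) :
    ∫ t in (0:ℝ)..1, bernoulliFun 1 t * ((x + t) ^ 1)⁻¹ =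
      1 - (x + 1 / 2) * (Real.log (x + 1) - Real.log x) := by
  have hpos : ∀ t ∈ Set.uIcc (0:ℝ) 1, 0 < x + t := by
    intro t ht
    rw [Set.uIcc_of_le zero_le_one] at ht
    linarith [ht.1]
  have := intervalIntegral.integral_eq_sub_of_hasDerivAt (a := 0) (b := 1)
    (f := fun t : ℝ => t - (x + 1 / 2) * Real.log (x + t))
    (f' := fun t : ℝ => bernoulliFun 1 t * ((x + t) ^ 1)⁻¹) ?_ ?_
  · rw [this]; simp; ring
  · intro t ht
    have h0 := (hpos t ht).ne'
    have h1 := (hasDerivAt_id t).sub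
      ((((hasDerivAt_id t).const_add x).log h0).const_mul (x + 1 / 2))
    convert! h1 using 1
    rw [bernoulliFun_one]
    simp only [id]
    field_simp
    ring
  · apply ContinuousOn.intervalIntegrable
    apply (continuous_bernoulliFun 1).continuousOn.mul
    apply ContinuousOn.inv₀
    · fun_prop
    · intro t ht
      exact pow_ne_zero _ (hpos t ht).ne'

/-- The term of the Stirling series. -/
noncomputable def stirTerm (n : ℕ) (x : ℝ) : ℝ :=
  (bernoulli (2 * n) : ℝ) / (2 * n * (2 * n - 1) * x ^ (2 * n - 1))

/-- The remainder of the Stirling series. -/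
noncomputable def stirRem (N : ℕ) (x : ℝ) : ℝ :=
  Real.log (Real.Gamma x)
        - (Real.log (Real.sqrt (2 * Real.pi)) + (x - 1 / 2) * Real.log x - x)
        - ∑ n ∈ Finset.Icc 1 N, stirTerm n x

lemma stirRem_succ (N : ℕ) (x : ℝ) : stirRem (N + 1) x = stirRem N x - stirTerm (N + 1) x := by
  unfold stirRem
  rw [Finset.sum_Icc_succ_top (by omega)]
  ring

lemma stirTerm_succ (n : ℕ) (x : ℝ) : stirTerm (n + 1) x =
    (bernoulli (2 * n + 2) : ℝ) / ((2 * n + 2) * (2 * n + 1) * x ^ (2 * n + 1)) := by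
  unfold stirTerm
  have h1 : 2 * (n + 1) = 2 * n + 2 := by ring
  have h2 : 2 * n + 2 - 1 = 2 * n + 1 := by omega
  rw [h1, h2]
  push_cast
  congr 2
  ring

lemma stirRem_diff (N : ℕ) (x : ℝ) (hx : 0 < x) :
    stirRem N x - stirRem N (x + 1) =
      -(∫ t in (0:ℝ)..1, bernoulliFun (2 * N + 1) t * ((x + t) ^ (2 * N + 1))⁻¹) / (2 * N + 1) := by
  induction N with
  | zero =>
    have := stir_J1 x hx
    simp only [mul_zero, zero_add, this]
    simp only [stirRem, Real.Gamma_add_one hx.ne',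
      Real.log_mul hx.ne' (Real.Gamma_pos_of_pos hx).ne']
    simp
    ring
  | succ N ih =>
    rw [stirRem_succ, stirRem_succ, stirTerm_succ, stirTerm_succ]
    have p1 := stir_parts x hx (2 * N + 1) 0
    have p2 := stir_parts x hx (2 * N + 2) 0
    have b3 : bernoulliFun (2 * N + 3) 0 = 0 := by
      rw [bernoulliFun_eval_zero, bernoulli_eq_zero_of_odd ⟨N + 1, by ring⟩ (by omega)]
      simp
    rw [bernoulliFun_endpoints_eq_of_ne_one (by omega), bernoulliFun_eval_zero] at p1
    rw [bernoulliFun_endpoints_eq_of_ne_one (by omega), b3] at p2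
    simp only [sub_zero, zero_div, zero_mul, sub_self, zero_add] at p1 p2
    rw [show 2 * N + 1 + 1 = 2 * N + 2 by ring, p2] at p1
    rw [show 2 * (N + 1) + 1 = 2 * N + 2 + 1 by ring]
    rw [p1] at ih
    have : stirRem N x = stirRem N (x + 1) + (stirRem N x - stirRem N (x + 1)) := by ring
    rw [this, ih]
    generalize (∫ t in (0:ℝ)..1, bernoulliFun (2 * N + 2 + 1) t * ((x + t) ^ (2 * N + 2 + 1))⁻¹) = J
    push_cast
    have h1 : (2 * (N:ℝ) + 1) ≠ 0 := by positivity
    have h2 : (2 * (N:ℝ) + 2) ≠ 0 := by positivity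
    have h3 : (2 * (N:ℝ) + 3) ≠ 0 := by positivity
    have h2' : (2 * (N:ℝ) + 1 + 1) ≠ 0 := by positivity
    have h3' : (2 * (N:ℝ) + 2 + 1) ≠ 0 := by positivity
    have h3'' : (2 * ((N:ℝ) + 1) + 1) ≠ 0 := by positivity
    have h4 : x ^ (2 * N + 1) ≠ 0 := by positivity
    have h5 : (x + 1) ^ (2 * N + 1) ≠ 0 := by positivity
    generalize x ^ (2 * N + 1) = a at *
    generalize (x + 1) ^ (2 * N + 1) = b at *
    have e1 : 2 * (N:ℝ) + 1 + 1 = 2 * N + 2 := by ring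
    have e2 : 2 * (N:ℝ) + 2 + 1 = 2 * N + 3 := by ring
    have e3 : 2 * ((N:ℝ) + 1) + 1 = 2 * N + 3 := by ring
    rw [e1, e2, e3]
    field_simp
    ring

lemma stir_bernFun_sign (k : ℕ) (hk : k ≠ 0) (t : ℝ) (ht : t ∈ Set.Icc (0:ℝ) 1) :
    0 ≤ (-1 : ℝ) ^ k * (bernoulliFun (2 * k) t - bernoulli (2 * k)) := by
  have h := hasSum_one_div_nat_pow_mul_cos hk ht
  have h' := hasSum_one_div_nat_pow_mul_cos hk (Set.left_mem_Icc.mpr (zero_le_one (α := ℝ)))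
  have h0 := hasSum_le (fun n => ?_) h h'
  · have hc : (0:ℝ) < (2 * π) ^ (2 * k) / 2 / (2 * k).factorial := by positivity
    have e := bernoulliFun_eval_zero (2 * k)
    unfold bernoulliFun at *
    rw [e] at h0
    have : 0 ≤ ((2 * π) ^ (2 * k) / 2 / (2 * k).factorial) *
      ((-1 : ℝ) ^ k * ((Polynomial.map (algebraMap ℚ ℝ) (Polynomial.bernoulli (2 * k))).eval t
        - bernoulli (2 * k))) := by
      rw [← sub_nonneg] at h0
      convert! h0 using 1; ring
    exact nonneg_of_mul_nonneg_right this hc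
  · simp only [mul_zero, Real.cos_zero]
    exact mul_le_mul_of_nonneg_left (Real.cos_le_one _) (by positivity)

lemma stirRem_diff_sign (N : ℕ) (x : ℝ) (hx : 0 < x) :
    0 ≤ (-1 : ℝ) ^ N * (stirRem N x - stirRem N (x + 1)) := by
  rw [stirRem_diff N x hx, stir_parts x hx _ (bernoulli (2 * (N + 1)) : ℝ)]
  rw [bernoulliFun_endpoints_eq_of_ne_one (by omega), bernoulliFun_eval_zero]
  have e : 2 * N + 1 + 1 = 2 * (N + 1) := by ring
  rw [e, sub_self]
  have hI : 0 ≤ ∫ t in (0:ℝ)..1, (-1 : ℝ) ^ (N + 1) * ((bernoulliFun (2 * (N + 1)) t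
      - bernoulli (2 * (N + 1))) * ((x + t) ^ (2 * (N + 1)))⁻¹) := by
    apply intervalIntegral.integral_nonneg zero_le_one
    intro t ht
    rw [← mul_assoc]
    have : 0 < x + t := by linarith [ht.1]
    exact mul_nonneg (stir_bernFun_sign _ (by omega) t ht) (by positivity)
  rw [intervalIntegral.integral_const_mul] at hI
  generalize (∫ t in (0:ℝ)..1, (bernoulliFun (2 * (N + 1)) t
      - bernoulli (2 * (N + 1))) * ((x + t) ^ (2 * (N + 1)))⁻¹) = I at *
  have h2 := mul_nonneg hI (by positivity :
    (0:ℝ) ≤ ((2 * N + 1 : ℕ) : ℝ) / (((2 * N + 1 : ℕ) : ℝ) + 1) / (2 * N + 1))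
  convert! h2 using 1
  ring

open Filter Topology in
lemma stirRem_zero_tendsto (x : ℝ) (hx : 0 < x) :
    Tendsto (fun n : ℕ => stirRem 0 (x + n)) atTop (𝓝 0) := by
  rw [← tendsto_add_atTop_iff_nat 1]
  have g := Real.BohrMollerup.tendsto_log_gamma hx
  have s := (Real.continuousAt_log (by positivity : √π ≠ 0)).tendsto.comp
    Stirling.tendsto_stirlingSeq_sqrt_pi
  have l := (Real.tendsto_mul_log_one_add_div_atTop (x + 1)).comp tendsto_natCast_atTop_atTop
  have l0 : Tendsto (fun n : ℕ => Real.log (1 + (x + 1) / n)) atTop (𝓝 0) := by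
    have : Tendsto (fun n : ℕ => 1 + (x + 1) / (n : ℝ)) atTop (𝓝 1) := by
      simpa using (tendsto_const_div_atTop_nhds_zero_nat (x + 1)).const_add 1
    have h2 := (Real.continuousAt_log one_ne_zero).tendsto.comp this
    rw [Real.log_one] at h2
    exact h2
  have key := ((((g.const_sub (Real.log (Real.Gamma x))).add s).sub l).sub
    (l0.const_mul (x + 1 / 2))).add_const (x + 1 - Real.log √π)
  have e : Real.log (Real.Gamma x) - Real.log (Real.Gamma x) + Real.log √π - (x + 1)
    - (x + 1 / 2) * 0 + (x + 1 - Real.log √π) = 0 := by ring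
  rw [e] at key
  refine key.congr' ?_
  filter_upwards [eventually_gt_atTop 0] with n hn
  have hn' : (0:ℝ) < n := by exact_mod_cast hn
  have f := Real.BohrMollerup.f_add_nat_eq (f := fun y => Real.log (Real.Gamma y)) (x := x)
    (fun {y} hy => by
      simp only [Real.Gamma_add_one hy.ne', Real.log_mul hy.ne' (Real.Gamma_pos_of_pos hy).ne']
      ring) hx (n + 1)
  simp only [Function.comp, stirRem, f, Real.BohrMollerup.logGammaSeq,
    Stirling.log_stirlingSeq_formula]
  have a1 : Real.log (1 + (x + 1) / n) = Real.log (x + n + 1) - Real.log n := by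
    rw [← Real.log_div (by positivity) hn'.ne']
    congr 1
    field_simp
    ring
  have a2 : Real.log √(2 * π) = 1 / 2 * Real.log 2 + Real.log √π := by
    rw [Real.log_sqrt (by positivity), Real.log_sqrt (by positivity),
      Real.log_mul (by norm_num) (by positivity)]
    ring
  rw [a1, a2, Real.log_mul (by norm_num) hn'.ne', Real.log_div hn'.ne' (Real.exp_pos 1).ne',
    Real.log_exp]
  push_cast
  rw [← add_assoc]
  simp
  ring

open Filter Topology in
lemma stirRem_tendsto (N : ℕ) (x : ℝ) (hx : 0 < x) :
    Tendsto (fun n : ℕ => stirRem N (x + n)) atTop (𝓝 0) := by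
  induction N with
  | zero => exact stirRem_zero_tendsto x hx
  | succ N ih =>
    simp only [stirRem_succ]
    have h : Tendsto (fun n : ℕ => stirTerm (N + 1) (x + n)) atTop (𝓝 0) := by
      simp only [stirTerm_succ]
      apply Tendsto.const_div_atTop
      apply Tendsto.const_mul_atTop (by positivity)
      exact (tendsto_pow_atTop (by omega)).comp
        (tendsto_atTop_add_const_left _ x tendsto_natCast_atTop_atTop)
    simpa using ih.sub h

open Filter Topology in
lemma stirRem_sign (N : ℕ) (x : ℝ) (hx : 0 < x) : 0 ≤ (-1 : ℝ) ^ N * stirRem N x := by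
  have ht := (stirRem_tendsto N x hx).const_mul ((-1 : ℝ) ^ N)
  rw [mul_zero] at ht
  have ha : Antitone (fun n : ℕ => (-1 : ℝ) ^ N * stirRem N (x + n)) := by
    apply antitone_nat_of_succ_le
    intro n
    have := stirRem_diff_sign N (x + n) (by positivity)
    push_cast
    rw [← add_assoc]
    linarith
  simpa using ha.le_of_tendsto ht 0

/-- The error of the truncated Stirling series for `log Γ` is bounded in absolute
value by the first omitted term. -/
theorem stirling_series_remainder_le_first_omitted_term
    (x : ℝ) (hx : 0 < x) (N : ℕ) (hN : 1 ≤ N) :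
    |Real.log (Real.Gamma x)
        - (Real.log (Real.sqrt (2 * Real.pi)) + (x - 1 / 2) * Real.log x - x)
        - ∑ n ∈ Finset.Icc 1 N,
            (bernoulli (2 * n) : ℝ) / (2 * n * (2 * n - 1) * x ^ (2 * n - 1))|
      ≤ |(bernoulli (2 * N + 2) : ℝ)| / ((2 * N + 2) * (2 * N + 1) * x ^ (2 * N + 1)) := by
  change |stirRem N x| ≤ _
  have h1 := stirRem_sign N x hx
  have h2 := stirRem_sign (N + 1) x hx
  rw [stirRem_succ, stirTerm_succ, pow_succ] at h2
  have hs : |(-1 : ℝ) ^ N| = 1 := by simp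
  have e1 : |stirRem N x| = (-1 : ℝ) ^ N * stirRem N x := by
    rw [← abs_of_nonneg h1, abs_mul, hs, one_mul]
  have e2 : (-1 : ℝ) ^ N * (bernoulli (2 * N + 2) : ℝ) ≤ |(bernoulli (2 * N + 2) : ℝ)| := by
    refine (le_abs_self _).trans ?_
    rw [abs_mul, hs, one_mul]
  have hD : (0:ℝ) < (2 * N + 2) * (2 * N + 1) * x ^ (2 * N + 1) := by positivity
  have e3 := div_le_div_of_nonneg_right e2 hD.le
  rw [mul_div_assoc] at e3
  rw [e1]
  linarith
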